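/- Let 0 < p < 1 and 0 < D < 1. Set m = 1 - p - D + 2pD, α = (1-p)(1-D)/m and β = p(1-D)/(1-m). Then H(p) - m·H(α) - (1-m)·H(β) = H(m) - H(D), where H is the binary entropy function. (This identifies the per-symbol directed information of the optimal nonanticipative reproduction of BSMS(p) with the value R^{na}(D) = H(m) - H(D) of Proposition 1.) -/

import Mathlib

open Real

/-- Grouping: the weighted binary entropy of a split of the mass `a + b`. -/
theorem add_mul_binEntropy_div_add {a b : ℝ} (ha : 0 < a) (hb : 0 < b) :
    (a + b) * binEntropy (a / (a + b))
      = negMulLog a + negMulLog b - negMulLog (a + b) := by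
  have hs : a + b ≠ 0 := (add_pos ha hb).ne'
  have hc : 1 - a / (a + b) = b / (a + b) := by field_simp; ring
  rw [binEntropy_eq_negMulLog_add_negMulLog_one_sub, hc]
  simp only [negMulLog, log_div ha.ne' hs, log_div hb.ne' hs]
  field_simp
  ring

theorem directed_information_equals_RDF
    (p D : ℝ) (hp0 : 0 < p) (hp1 : p < 1) (hD0 : 0 < D) (hD1 : D < 1)
    (m α β : ℝ) (hm : m = 1 - p - D + 2 * p * D)
    (hα : α = (1 - p) * (1 - D) / m) (hβ : β = p * (1 - D) / (1 - m)) :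
    binEntropy p - m * binEntropy α - (1 - m) * binEntropy β
      = binEntropy m - binEntropy D := by
  have hp : 0 < 1 - p := sub_pos.2 hp1
  have hD : 0 < 1 - D := sub_pos.2 hD1
  have hm_split : m = (1 - p) * (1 - D) + p * D := by rw [hm]; ring
  have hm_compl : 1 - m = p * (1 - D) + (1 - p) * D := by rw [hm]; ring
  have hmα := add_mul_binEntropy_div_add (mul_pos hp hD) (mul_pos hp0 hD0)
  have hmβ := add_mul_binEntropy_div_add (mul_pos hp0 hD) (mul_pos hp hD0)
  rw [← hm_split, ← hα] at hmα
  rw [← hm_compl, ← hβ] at hmβ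
  rw [hmα, hmβ]
  simp only [binEntropy_eq_negMulLog_add_negMulLog_one_sub, negMulLog_mul]
  ring
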